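/- Let q > 0 and λ > 0. Then sup_{θ∈[0,1]} Φ(θ,λ,q) = g(θ(λ,q))/(2q) − ((q−1)/(2q))λ + log q, where g : [0,1) → ℝ is defined by g(θ) = −(q−1)(2−θ) log(1−θ) − [2+(q−1)θ] log[1+(q−1)θ] (so g(0)=0), θ(λ,q) = 0 if λ < λ_c(q) and θ(λ,q) = θ_max if λ ≥ λ_c(q), where λ_c(q) = q if q ≤ 2 and λ_c(q) = 2((q−1)/(q−2)) log(q−1) if q > 2, and θ_max is the largest solution θ ∈ [0,1) of the mean field equation e^{−λθ} = (1−θ)/(1+(q−1)θ). -/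

import Mathlib

open Filter Topology Set

noncomputable section

/-- Size of the connected component of `K_n(ω)` containing the vertex `v`. -/
def compSize {n : ℕ} (G : SimpleGraph (Fin n)) (v : Fin n) : ℕ :=
  (G.connectedComponentMk v).supp.ncard

/-- Random cluster weight of a configuration `G` on the complete graph `K_m`,
with edge weight `p` and cluster weight `q`. -/
def rcW (m : ℕ) (p q : ℝ) (G : SimpleGraph (Fin m)) : ℝ :=
  p ^ G.edgeSet.ncard * (1 - p) ^ (m * (m - 1) / 2 - G.edgeSet.ncard) *
    q ^ Nat.card G.ConnectedComponent

/-- Total random-cluster weight of an event, with explicit edge weight `p`. -/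
def ZP (m : ℕ) (p q : ℝ) (A : Set (SimpleGraph (Fin m))) : ℝ :=
  ∑ᶠ G ∈ A, rcW m p q G

/-- `Z_{n,λ,q}[A]`, i.e. the total weight of the event `A` with `p = λ/n`. -/
def Zrc (n : ℕ) (lam q : ℝ) (A : Set (SimpleGraph (Fin n))) : ℝ :=
  ZP n (lam / n) q A

/-- The partition function `Z_{n,λ,q}`. -/
def Ztot (n : ℕ) (lam q : ℝ) : ℝ := Zrc n lam q Set.univ

/-- The random cluster probability `φ_{n,λ,q}[A]`. -/
def phiRC (n : ℕ) (lam q : ℝ) (A : Set (SimpleGraph (Fin n))) : ℝ :=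
  Zrc n lam q A / Ztot n lam q

/-- The event `K` that the configuration is connected. -/
def Kev (n : ℕ) : Set (SimpleGraph (Fin n)) := {G | G.Connected}

/-- The event `B_r` that no connected component has size larger than `r`. -/
def Bev (n : ℕ) (r : ℝ) : Set (SimpleGraph (Fin n)) :=
  {G | ∀ v, (compSize G v : ℝ) ≤ r}

/-- The event `L` that the configuration is acyclic. -/
def Lev (n : ℕ) : Set (SimpleGraph (Fin n)) := {G | G.IsAcyclic}

/-- The set `V_r` of vertices lying in components of size larger than `r`. -/
def Vbig {n : ℕ} (G : SimpleGraph (Fin n)) (r : ℝ) : Set (Fin n) :=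
  {v | r < (compSize G v : ℝ)}

/-- The number `N_r` of connected components of size larger than `r`. -/
def Nbig {n : ℕ} (G : SimpleGraph (Fin n)) (r : ℝ) : ℕ :=
  {C : G.ConnectedComponent | r < (C.supp.ncard : ℝ)}.ncard

def pi1 (x : ℝ) : ℝ := 1 - Real.exp (-x)

def Psi (x : ℝ) : ℝ := min (Real.log x - (x - 1/x) / 2) 0

def Sent (θ : ℝ) : ℝ := θ * Real.log θ + (1 - θ) * Real.log (1 - θ)

def Phi (θ lam q : ℝ) : ℝ :=
  -Sent θ + (1 - θ) * Real.log (1 - pi1 (lam * θ)) + θ * Real.log (pi1 (lam * θ)) +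
    (1 - θ) * (Psi (lam * (1 - θ) / q) - ((q - 1) / (2 * q)) * (lam * (1 - θ)) + Real.log q)

/-- `g(θ) = −(q−1)(2−θ) log(1−θ) − [2+(q−1)θ] log[1+(q−1)θ]`. -/
def gfun (q θ : ℝ) : ℝ :=
  -(q - 1) * (2 - θ) * Real.log (1 - θ) - (2 + (q - 1) * θ) * Real.log (1 + (q - 1) * θ)

/-- The critical value `λ_c(q)`. -/
def lamCrit (q : ℝ) : ℝ :=
  if q ≤ 2 then q else 2 * ((q - 1) / (q - 2)) * Real.log (q - 1)

/-- `θ_max`, the largest solution `θ ∈ [0,1)` of the mean field equation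
`e^{−λθ} = (1−θ)/(1+(q−1)θ)`. -/
def thetaMax (lam q : ℝ) : ℝ :=
  sSup {θ : ℝ | θ ∈ Set.Ico (0:ℝ) 1 ∧
    Real.exp (-lam * θ) = (1 - θ) / (1 + (q - 1) * θ)}

/-- `θ(λ,q) = 0` if `λ < λ_c(q)`, and `θ(λ,q) = θ_max` otherwise. -/
def thetaStar (lam q : ℝ) : ℝ := if lam < lamCrit q then 0 else thetaMax lam q

open Real in
def FF (q l θ : ℝ) : ℝ :=
  -(θ * log θ) - (1 - θ) * log (1 - θ) - l * θ * (1 - θ) + θ * log (1 - exp (-(l * θ)))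
    + (1 - θ) * (log q - (q - 1) / (2 * q) * (l * (1 - θ)))

open Real in
def GG (q l θ : ℝ) : ℝ :=
  -(θ * log θ) + θ * log (1 - exp (-(l * θ))) + (1 - θ) * log l + q / (2 * l)
    - l * (1 - θ ^ 2) / 2

open Real in
def EE (q l θ : ℝ) : ℝ := (1 - θ) * exp (l * θ) - (1 + (q - 1) * θ)

open Real in
def HH (q l θ : ℝ) : ℝ :=
  log q - (1 / q) * ((1 + (q - 1) * θ) * log (1 + (q - 1) * θ)
    + (q - 1) * ((1 - θ) * log (1 - θ))) - (q - 1) / (2 * q) * l * (1 - θ ^ 2)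

open Real in
def DD (q l θ : ℝ) : ℝ := l * θ - log (1 + (q - 1) * θ) + log (1 - θ)

lemma upos {q θ : ℝ} (hq : 0 < q) (h0 : 0 ≤ θ) (h1 : θ ≤ 1) : 0 < 1 + (q - 1) * θ := by
  rcases eq_or_lt_of_le h1 with h | h
  · subst h; linarith
  · nlinarith

lemma cont_xlog : ContinuousOn (fun x : ℝ => x * Real.log (1 - Real.exp (-x))) (Ici 0) := by
  intro x hx
  rcases eq_or_lt_of_le (mem_Ici.1 hx) with h | h
  · subst h
    unfold ContinuousWithinAt
    have e0 : (0:ℝ) * Real.log (1 - Real.exp (-0)) = 0 := by simp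
    beta_reduce
    rw [e0]
    have hlow : Tendsto (fun x : ℝ => x * Real.log x - x ^ 2) (𝓝[Ici 0] 0) (𝓝 0) := by
      have : Continuous (fun x : ℝ => x * Real.log x - x ^ 2) :=
        Real.continuous_mul_log.sub (by fun_prop)
      have h2 := this.tendsto 0
      simp at h2
      exact h2.mono_left nhdsWithin_le_nhds
    refine tendsto_of_tendsto_of_tendsto_of_le_of_le' hlow tendsto_const_nhds ?_ ?_
    · filter_upwards [self_mem_nhdsWithin] with y hy
      rcases eq_or_lt_of_le (mem_Ici.1 hy) with h | h
      · subst h; simp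
      · have h3 : y * Real.exp (-y) ≤ 1 - Real.exp (-y) := by
          have := Real.add_one_le_exp y
          have h4 : Real.exp y * Real.exp (-y) = 1 := by rw [← Real.exp_add]; simp
          nlinarith [Real.exp_pos (-y)]
        have h5 := Real.log_le_log (by positivity) h3
        rw [Real.log_mul h.ne' (Real.exp_pos _).ne', Real.log_exp] at h5
        nlinarith
    · filter_upwards [self_mem_nhdsWithin] with y hy
      have hy' : 0 ≤ y := hy
      apply mul_nonpos_of_nonneg_of_nonpos hy'
      apply Real.log_nonpos
      · have : Real.exp (-y) ≤ 1 := Real.exp_le_one_iff.2 (by linarith)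
        linarith
      · linarith [Real.exp_pos (-y)]
  · apply ContinuousAt.continuousWithinAt
    have : Real.exp (-x) < 1 := by rw [Real.exp_lt_one_iff]; linarith
    have h2 : 1 - Real.exp (-x) ≠ 0 := by linarith
    fun_prop (disch := assumption)

lemma cont_tlog (l : ℝ) (hl : 0 < l) :
    ContinuousOn (fun θ : ℝ => θ * Real.log (1 - Real.exp (-(l * θ)))) (Ici 0) := by
  have h := cont_xlog.comp (s := Ici 0) (f := fun θ : ℝ => l * θ) (by fun_prop)
    (fun x hx => mul_nonneg hl.le (mem_Ici.1 hx))
  have h2 := h.const_smul l⁻¹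
  refine h2.congr (fun x _ => ?_)
  simp only [Function.comp, smul_eq_mul, Pi.smul_apply]
  field_simp

lemma cont_1mlog : Continuous (fun θ : ℝ => (1 - θ) * Real.log (1 - θ)) :=
  Real.continuous_mul_log.comp (by fun_prop : Continuous fun θ : ℝ => 1 - θ)

lemma FF_cont (q l : ℝ) (hl : 0 < l) : ContinuousOn (FF q l) (Ici 0) := by
  unfold FF
  exact (((Real.continuous_mul_log.neg.sub cont_1mlog).sub (by fun_prop)).continuousOn.add
    (cont_tlog l hl)).add (by fun_prop)

lemma GG_cont (q l : ℝ) (hl : 0 < l) : ContinuousOn (GG q l) (Ici 0) := by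
  unfold GG
  exact (((Real.continuous_mul_log.neg.continuousOn.add (cont_tlog l hl)).add (by fun_prop)).add
    (by fun_prop)).sub (by fun_prop)

lemma z_lt {l θ : ℝ} (hl : 0 < l) (h0 : 0 < θ) : Real.exp (-(l * θ)) < 1 := by
  rw [Real.exp_lt_one_iff]; nlinarith

lemma tlog_deriv {l θ : ℝ} (hl : 0 < l) (h0 : 0 < θ) :
    HasDerivAt (fun θ : ℝ => θ * Real.log (1 - Real.exp (-(l * θ))))
      (Real.log (1 - Real.exp (-(l * θ))) +
        l * (θ * Real.exp (-(l * θ)) / (1 - Real.exp (-(l * θ))))) θ := by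
  have hz := z_lt hl h0
  have h1 : HasDerivAt (fun θ : ℝ => -(l * θ)) (-l) θ := by
    exact ((hasDerivAt_id' θ).const_mul l).fun_neg.congr_deriv (by ring)
  have h2 := (h1.exp.const_sub 1).log (by linarith)
  have h3 := (hasDerivAt_id' θ).mul h2
  refine h3.congr_deriv ?_
  ring

lemma FF_deriv {q l θ : ℝ} (hq : 0 < q) (hl : 0 < l) (h0 : 0 < θ) (h1 : θ < 1) :
    HasDerivAt (FF q l) (Real.log ((1 - θ) / q) -
      Real.log (θ * Real.exp (-(l * θ)) / (1 - Real.exp (-(l * θ)))) +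
      l * (θ * Real.exp (-(l * θ)) / (1 - Real.exp (-(l * θ))) - (1 - θ) / q)) θ := by
  have hz := z_lt hl h0
  have hid : HasDerivAt (fun θ : ℝ => 1 - θ) (-1) θ := by
    simpa using (hasDerivAt_id θ).const_sub 1
  have a1 := (Real.hasDerivAt_mul_log h0.ne').neg
  have a2 := (Real.hasDerivAt_mul_log (x := 1 - θ) (by linarith)).comp θ hid
  have a3 := (((hasDerivAt_id' θ).const_mul l).mul hid)
  have a4 := tlog_deriv hl h0
  have a5 := hid.mul (((hid.const_mul l).const_mul ((q - 1) / (2 * q))).const_sub (Real.log q))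
  have := (((a1.sub a2).sub a3).add a4).add a5
  refine this.congr_deriv ?_
  rw [Real.log_div (by linarith) hq.ne', Real.log_div (mul_pos h0 (Real.exp_pos _)).ne' (by linarith),
    Real.log_mul h0.ne' (Real.exp_pos _).ne', Real.log_exp]
  field_simp
  ring

lemma GG_deriv {q l θ : ℝ} (hl : 0 < l) (h0 : 0 < θ) :
    HasDerivAt (GG q l) (l * θ / (1 - Real.exp (-(l * θ))) - 1 -
      Real.log (l * θ / (1 - Real.exp (-(l * θ))))) θ := by
  have hz := z_lt hl h0
  have hid : HasDerivAt (fun θ : ℝ => 1 - θ) (-1) θ := by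
    simpa using (hasDerivAt_id θ).const_sub 1
  have a1 := (Real.hasDerivAt_mul_log h0.ne').neg
  have a4 := tlog_deriv hl h0
  have a5 := hid.mul_const (Real.log l)
  have a6 := ((((hasDerivAt_id' θ).pow 2).const_sub 1).const_mul l).div_const 2
  have := (((a1.add a4).add a5).add_const (q / (2 * l))).sub a6
  refine this.congr_deriv ?_
  have hne : 1 - Real.exp (-(l * θ)) ≠ 0 := by linarith
  rw [Real.log_div (by positivity) hne, Real.log_mul hl.ne' h0.ne']
  field_simp
  ring

lemma GG_mono {q l : ℝ} (hl : 0 < l) : MonotoneOn (GG q l) (Ici 0) := by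
  refine monotoneOn_of_deriv_nonneg (convex_Ici 0) (GG_cont q l hl) ?_ ?_
  · intro x hx
    rw [interior_Ici] at hx
    exact (GG_deriv hl hx).differentiableAt.differentiableWithinAt
  · intro x hx
    rw [interior_Ici] at hx
    rw [(GG_deriv hl hx).deriv]
    have hx' : 0 < x := hx
    have hz := z_lt hl hx'
    have : 0 < l * x / (1 - Real.exp (-(l * x))) := by
      apply div_pos (by positivity); linarith
    linarith [Real.log_le_sub_one_of_pos this]

/-- `A ≤ 1/λ` and the sign of `E` compares `A` and `B`. -/
lemma A_facts {q l θ : ℝ} (hq : 0 < q) (hl : 0 < l) (h0 : 0 < θ) :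
    0 < θ * Real.exp (-(l * θ)) / (1 - Real.exp (-(l * θ))) ∧
    l * (θ * Real.exp (-(l * θ)) / (1 - Real.exp (-(l * θ)))) ≤ 1 ∧
    (0 ≤ EE q l θ → θ * Real.exp (-(l * θ)) / (1 - Real.exp (-(l * θ))) ≤ (1 - θ) / q) ∧
    (EE q l θ ≤ 0 → (1 - θ) / q ≤ θ * Real.exp (-(l * θ)) / (1 - Real.exp (-(l * θ)))) := by
  have hz := z_lt hl h0
  have hp := Real.exp_pos (-(l * θ))
  have hw : 0 < 1 - Real.exp (-(l * θ)) := by linarith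
  have hm : Real.exp (l * θ) * Real.exp (-(l * θ)) = 1 := by rw [← Real.exp_add]; simp
  have he := Real.add_one_le_exp (l * θ)
  refine ⟨by positivity, ?_, ?_, ?_⟩
  · rw [← mul_div_assoc, div_le_one hw]
    nlinarith
  · intro h
    unfold EE at h
    rw [div_le_div_iff₀ hw hq]
    nlinarith [mul_nonneg h hp.le]
  · intro h
    unfold EE at h
    rw [div_le_div_iff₀ hq hw]
    nlinarith [mul_nonneg (neg_nonneg.2 h) hp.le]

lemma FF_mono {q l a b : ℝ} (hq : 0 < q) (hl : 0 < l) (ha : 0 ≤ a) (hb : b < 1)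
    (hreg : l * (1 - a) ≤ q) (hE : ∀ θ ∈ Ioo a b, 0 ≤ EE q l θ) :
    MonotoneOn (FF q l) (Icc a b) := by
  refine monotoneOn_of_deriv_nonneg (convex_Icc a b)
    ((FF_cont q l hl).mono fun x hx => ha.trans hx.1) ?_ ?_
  · intro x hx
    rw [interior_Icc] at hx
    exact (FF_deriv hq hl (ha.trans_lt hx.1) (hx.2.trans hb)).differentiableAt.differentiableWithinAt
  · intro x hx
    rw [interior_Icc] at hx
    have h0 : 0 < x := ha.trans_lt hx.1
    have h1 : x < 1 := hx.2.trans hb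
    rw [(FF_deriv hq hl h0 h1).deriv]
    obtain ⟨hA, -, hAB, -⟩ := A_facts (q := q) hq hl h0
    have hAB := hAB (hE x hx)
    set A := x * Real.exp (-(l * x)) / (1 - Real.exp (-(l * x)))
    have hB : 0 < (1 - x) / q := div_pos (by linarith) hq
    have hlB : l * ((1 - x) / q) ≤ 1 := by
      rw [← mul_div_assoc, div_le_one hq]
      nlinarith [hx.1]
    set B := (1 - x) / q
    have := Real.log_le_sub_one_of_pos (div_pos hA hB)
    rw [Real.log_div hA.ne' hB.ne'] at this
    have h3 : l * (B - A) ≤ 1 - A / B := by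
      have : 1 - A / B = (B - A) / B := by field_simp
      rw [this, le_div_iff₀ hB]
      nlinarith
    linarith

lemma FF_anti {q l a : ℝ} (hq : 0 < q) (hl : 0 < l) (ha : 0 ≤ a)
    (hE : ∀ θ ∈ Ioo a 1, EE q l θ ≤ 0) :
    AntitoneOn (FF q l) (Icc a 1) := by
  refine antitoneOn_of_deriv_nonpos (convex_Icc a 1)
    ((FF_cont q l hl).mono fun x hx => ha.trans hx.1) ?_ ?_
  · intro x hx
    rw [interior_Icc] at hx
    exact (FF_deriv hq hl (ha.trans_lt hx.1) hx.2).differentiableAt.differentiableWithinAt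
  · intro x hx
    rw [interior_Icc] at hx
    have h0 : 0 < x := ha.trans_lt hx.1
    rw [(FF_deriv hq hl h0 hx.2).deriv]
    obtain ⟨hA, hlA, -, hAB⟩ := A_facts (q := q) hq hl h0
    have hAB := hAB (hE x hx)
    set A := x * Real.exp (-(l * x)) / (1 - Real.exp (-(l * x)))
    have hB : 0 < (1 - x) / q := div_pos (by linarith [hx.2]) hq
    set B := (1 - x) / q
    have := Real.log_le_sub_one_of_pos (div_pos hB hA)
    rw [Real.log_div hB.ne' hA.ne'] at this
    have h3 : l * (A - B) ≤ 1 - B / A := by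
      have : 1 - B / A = (A - B) / A := by field_simp
      rw [this, le_div_iff₀ hA]
      nlinarith
    linarith

lemma log_le_half {y : ℝ} (hy : 1 ≤ y) : Real.log y ≤ (y - 1 / y) / 2 := by
  have h := Real.self_le_sinh_iff.2 (Real.log_nonneg hy)
  rw [Real.sinh_log (by linarith)] at h
  simpa using h

lemma Psi_zero {x : ℝ} (h0 : 0 < x) (h1 : x ≤ 1) : Psi x = 0 := by
  unfold Psi
  apply min_eq_right
  have := log_le_half (y := 1 / x) (by rw [le_div_iff₀ h0]; linarith)
  rw [one_div_one_div, one_div, Real.log_inv] at this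
  rw [one_div]
  linarith

lemma Phi_eq (θ l q : ℝ) :
    Phi θ l q = FF q l θ + (1 - θ) * Psi (l * (1 - θ) / q) := by
  unfold Phi FF Sent pi1
  rw [sub_sub_cancel, Real.log_exp]
  ring

lemma Phi_le_FF {θ l q : ℝ} (h1 : θ ≤ 1) : Phi θ l q ≤ FF q l θ := by
  rw [Phi_eq]
  have : Psi (l * (1 - θ) / q) ≤ 0 := min_le_right _ _
  nlinarith

lemma Phi_eq_FF {θ l q : ℝ} (hq : 0 < q) (hl : 0 < l) (h1 : θ < 1) (h : l * (1 - θ) ≤ q) :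
    Phi θ l q = FF q l θ := by
  rw [Phi_eq, Psi_zero]
  · ring
  · exact div_pos (mul_pos hl (by linarith)) hq
  · rwa [div_le_one hq]

lemma FF_psi_eq_GG {θ l q : ℝ} (hq : 0 < q) (hl : 0 < l) (h1 : θ < 1) :
    FF q l θ + (1 - θ) * (Real.log (l * (1 - θ) / q) -
      (l * (1 - θ) / q - 1 / (l * (1 - θ) / q)) / 2) = GG q l θ := by
  have h2 : 0 < 1 - θ := by linarith
  rw [Real.log_div (by positivity) hq.ne', Real.log_mul hl.ne' h2.ne']
  unfold FF GG
  field_simp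
  ring

lemma Phi_le_GG {θ l q : ℝ} (hq : 0 < q) (hl : 0 < l) (h1 : θ < 1) :
    Phi θ l q ≤ GG q l θ := by
  rw [Phi_eq, ← FF_psi_eq_GG hq hl h1]
  have : Psi (l * (1 - θ) / q) ≤ _ := min_le_left _ _
  have := mul_le_mul_of_nonneg_left this (by linarith : 0 ≤ 1 - θ)
  linarith

lemma GG_eq_FF {l q : ℝ} (hq : 0 < q) (hl : 0 < l) : GG q l (1 - q / l) = FF q l (1 - q / l) := by
  have : 0 < q / l := by positivity
  rw [← FF_psi_eq_GG hq hl (by linarith)]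
  have : l * (1 - (1 - q / l)) / q = 1 := by field_simp; ring
  rw [this]; simp

/-- Upper bound used when `q ≤ 2`. -/
lemma small_bound {q l t : ℝ} (hq : 0 < q) (hl : 0 < l) (ht1 : t < 1) (ht0 : 0 ≤ t)
    (hreg : l * (1 - t) ≤ q)
    (hp : ∀ θ, 0 < θ → θ < t → 0 ≤ EE q l θ) (hn : ∀ θ, t < θ → θ < 1 → EE q l θ ≤ 0)
    {θ : ℝ} (h0 : 0 ≤ θ) (h1 : θ ≤ 1) : Phi θ l q ≤ FF q l t := by
  rcases le_total t θ with h | h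
  · refine (Phi_le_FF h1).trans ?_
    exact FF_anti hq hl ht0 (fun x hx => hn x hx.1 hx.2) ⟨le_rfl, ht1.le⟩ ⟨h, h1⟩ h
  · rcases le_total (l * (1 - θ)) q with h2 | h2
    · refine (Phi_le_FF h1).trans ?_
      exact FF_mono hq hl h0 ht1 h2 (fun x hx => hp x (h0.trans_lt hx.1) hx.2)
        ⟨le_rfl, h⟩ ⟨h, le_rfl⟩ h
    · have hm : θ ≤ 1 - q / l := by
        have : q / l ≤ 1 - θ := by rw [div_le_iff₀ hl]; linarith
        linarith
      have hmt : 1 - q / l ≤ t := by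
        have : 1 - t ≤ q / l := by rw [le_div_iff₀ hl]; linarith
        linarith
      refine (Phi_le_GG hq hl (h.trans_lt ht1)).trans ((GG_mono hl (mem_Ici.2 h0)
        (mem_Ici.2 (h0.trans hm)) hm).trans ?_)
      rw [GG_eq_FF hq hl]
      refine FF_mono hq hl (h0.trans hm) ht1 (le_of_eq ?_)
        (fun x hx => hp x ((h0.trans hm).trans_lt hx.1) hx.2) ⟨le_rfl, hmt⟩ ⟨hmt, le_rfl⟩ hmt
      field_simp; ring

/-- sign of `D` is the sign of `E`. -/
lemma DD_EE {q l θ : ℝ} (hq : 0 < q) (h0 : 0 ≤ θ) (h1 : θ < 1) :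
    (0 ≤ DD q l θ ↔ 0 ≤ EE q l θ) ∧ (DD q l θ ≤ 0 ↔ EE q l θ ≤ 0) := by
  have hu := upos hq h0 h1.le
  have hv : 0 < 1 - θ := by linarith
  have e : DD q l θ = Real.log ((1 - θ) * Real.exp (l * θ)) - Real.log (1 + (q - 1) * θ) := by
    rw [Real.log_mul hv.ne' (Real.exp_pos _).ne', Real.log_exp]; unfold DD; ring
  have hw : 0 < (1 - θ) * Real.exp (l * θ) := by positivity
  unfold EE
  rw [e, sub_nonneg, sub_nonneg, sub_nonpos, sub_nonpos]
  exact ⟨Real.log_le_log_iff hu hw, Real.log_le_log_iff hw hu⟩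

lemma DD_deriv {q l θ : ℝ} (hq : 0 < q) (h0 : 0 ≤ θ) (h1 : θ < 1) :
    HasDerivAt (DD q l) (l - (q - 1) / (1 + (q - 1) * θ) - 1 / (1 - θ)) θ := by
  have hu := upos hq h0 h1.le
  have b1 : HasDerivAt (fun θ : ℝ => 1 + (q - 1) * θ) (q - 1) θ :=
    (((hasDerivAt_id' θ).const_mul (q - 1)).const_add 1).congr_deriv (by ring)
  have b2 : HasDerivAt (fun θ : ℝ => 1 - θ) (-1) θ := (hasDerivAt_id' θ).const_sub 1
  have := (((hasDerivAt_id' θ).const_mul l).sub (b1.log hu.ne')).add (b2.log (by linarith))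
  refine this.congr_deriv ?_
  ring

lemma DD_concave {q l c : ℝ} (hq : 0 < q) (hc : 0 ≤ c) (h : q - 2 ≤ 2 * (q - 1) * c) :
    ConcaveOn ℝ (Ico c 1) (DD q l) := by
  have key : ∀ x ∈ Ico c 1, HasDerivAt (DD q l) (l - (q - 1) / (1 + (q - 1) * x) - 1 / (1 - x)) x :=
    fun x hx => DD_deriv hq (hc.trans hx.1) hx.2
  refine AntitoneOn.concaveOn_of_deriv (convex_Ico c 1)
    (fun x hx => (key x hx).continuousAt.continuousWithinAt)
    (fun x hx => (key x (interior_subset hx)).differentiableAt.differentiableWithinAt) ?_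
  intro x hx y hy hxy
  rw [interior_Ico] at hx hy
  rw [(key x ⟨hx.1.le, hx.2⟩).deriv, (key y ⟨hy.1.le, hy.2⟩).deriv]
  have hux := upos hq (hc.trans hx.1.le) hx.2.le
  have huy := upos hq (hc.trans hy.1.le) hy.2.le
  have e : ∀ z : ℝ, 0 < 1 + (q - 1) * z → z < 1 →
      (q - 1) / (1 + (q - 1) * z) + 1 / (1 - z) = q / ((1 + (q - 1) * z) * (1 - z)) := by
    intro z hz hz1
    have : 1 - z ≠ 0 := by linarith
    field_simp
    ring
  have ex := e x hux hx.2
  have ey := e y huy hy.2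
  have : q / ((1 + (q - 1) * x) * (1 - x)) ≤ q / ((1 + (q - 1) * y) * (1 - y)) := by
    apply div_le_div_of_nonneg_left hq.le (mul_pos huy (by linarith [hy.2]))
    have : q - 2 ≤ (q - 1) * (x + y) := by
      rcases le_total 1 q with h1 | h1
      · nlinarith [hx.1, hy.1]
      · nlinarith [hx.2, hy.2]
    nlinarith
  linarith

lemma conc_nonneg {f : ℝ → ℝ} {c a b x : ℝ} (hf : ConcaveOn ℝ (Ico c 1) f) (ha : c ≤ a)
    (hb : b < 1) (hax : a ≤ x) (hxb : x ≤ b) (fa : 0 ≤ f a) (fb : 0 ≤ f b) : 0 ≤ f x := by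
  have h : x ∈ segment ℝ a b := by
    rw [segment_eq_Icc (hax.trans hxb)]; exact ⟨hax, hxb⟩
  have := hf.ge_on_segment (x := a) (y := b) ⟨ha, (hax.trans hxb).trans_lt hb⟩
    ⟨(ha.trans hax).trans hxb, hb⟩ h
  exact (le_min fa fb).trans this

/-- Existence and properties of `θ_max`. -/
lemma thetaMax_props {q l c : ℝ} (hq : 0 < q) (hl : 0 < l) (hc : 0 ≤ c) (hc1 : c < 1)
    (h : q - 2 ≤ 2 * (q - 1) * c) (hE : 0 ≤ EE q l c) :
    c ≤ thetaMax l q ∧ thetaMax l q < 1 ∧ EE q l (thetaMax l q) = 0 ∧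
    (∀ θ, c ≤ θ → θ ≤ thetaMax l q → 0 ≤ EE q l θ) ∧
    (∀ θ, thetaMax l q < θ → θ ≤ 1 → EE q l θ < 0) ∧ l * (1 - thetaMax l q) ≤ q := by
  have hcont : Continuous (EE q l) := by unfold EE; fun_prop
  have hE1 : EE q l 1 < 0 := by unfold EE; linarith
  have hset : {θ : ℝ | θ ∈ Set.Ico (0:ℝ) 1 ∧
      Real.exp (-l * θ) = (1 - θ) / (1 + (q - 1) * θ)} = Icc 0 1 ∩ EE q l ⁻¹' {0} := by
    ext θ
    simp only [mem_ofPred_eq, mem_inter_iff, mem_preimage, mem_singleton_iff]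
    have hm : Real.exp (l * θ) * Real.exp (-l * θ) = 1 := by rw [← Real.exp_add]; simp
    have hp := Real.exp_pos (l * θ)
    have hp' := Real.exp_pos (-l * θ)
    constructor
    · rintro ⟨h1, h2⟩
      have hu := upos hq h1.1 h1.2.le
      refine ⟨⟨h1.1, h1.2.le⟩, ?_⟩
      rw [eq_div_iff hu.ne'] at h2
      unfold EE
      rw [← h2]
      linear_combination (1 + (q - 1) * θ) * hm
    · rintro ⟨h1, h2⟩
      have hu := upos hq h1.1 h1.2
      refine ⟨⟨h1.1, lt_of_le_of_ne h1.2 ?_⟩, ?_⟩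
      · rintro rfl
        linarith
      · rw [eq_div_iff hu.ne']
        unfold EE at h2
        linear_combination (1 - θ) * hm - Real.exp (-l * θ) * h2
  have hcomp : IsCompact (Icc (0:ℝ) 1 ∩ EE q l ⁻¹' {0}) :=
    isCompact_Icc.inter_right (isClosed_singleton.preimage hcont)
  have hne : (Icc (0:ℝ) 1 ∩ EE q l ⁻¹' {0}).Nonempty := ⟨0, by simp, by simp [EE]⟩
  obtain ⟨t, ht⟩ := hcomp.exists_isGreatest hne
  have htm : thetaMax l q = t := by
    unfold thetaMax
    rw [hset]; exact ht.csSup_eq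
  rw [htm]
  have hroot : ∀ a, 0 ≤ a → a ≤ 1 → 0 ≤ EE q l a → a ≤ t := by
    intro a ha0 ha1 ha
    have := intermediate_value_Icc' ha1 hcont.continuousOn
    obtain ⟨r, hr, hr0⟩ := this ⟨hE1.le, ha⟩
    exact hr.1.trans (ht.2 ⟨⟨ha0.trans hr.1, hr.2⟩, hr0⟩)
  have hEt : EE q l t = 0 := ht.1.2
  have ht1 : t < 1 := lt_of_le_of_ne ht.1.1.2 (by rintro rfl; linarith)
  have hct : c ≤ t := hroot c hc hc1.le hE
  have hneg : ∀ θ, t < θ → θ ≤ 1 → EE q l θ < 0 := by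
    intro θ h1 h2
    by_contra! h3
    linarith [hroot θ (ht.1.1.1.trans h1.le) h2 h3]
  refine ⟨hct, ht1, hEt, ?_, hneg, ?_⟩
  · intro θ h1 h2
    rw [← (DD_EE hq (hc.trans h1) (h2.trans_lt ht1)).1]
    refine conc_nonneg (DD_concave hq hc h) le_rfl ht1 h1 h2 ?_ ?_
    · rwa [(DD_EE hq hc hc1).1]
    · rw [(DD_EE hq ht.1.1.1 ht1).1, hEt]
  · by_contra! h3
    -- choose a point slightly above `t`
    obtain ⟨s, hs1, hs2⟩ : ∃ s, t < s ∧ s < min 1 (1 - q / l) := by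
      apply exists_between
      apply lt_min ht1
      have : q / l < 1 - t := by rw [div_lt_iff₀ hl]; linarith
      linarith
    have hs3 : s < 1 := hs2.trans_le (min_le_left _ _)
    have hs4 : s < 1 - q / l := hs2.trans_le (min_le_right _ _)
    have hs5 : q < l * (1 - s) := by
      have : q / l < 1 - s := by linarith
      rw [div_lt_iff₀ hl] at this; linarith
    have h4 := hneg s hs1 hs3.le
    unfold EE at h4
    have h5 := Real.add_one_le_exp (l * s)
    have hs0 : 0 < s := ht.1.1.1.trans_lt hs1
    nlinarith [mul_le_mul_of_nonneg_left h5 (by linarith : 0 ≤ 1 - s)]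

lemma EE_neg {q l : ℝ} (hq : 0 < q) (hq2 : q ≤ 2) (hlq : l ≤ q) {θ : ℝ} (h0 : 0 ≤ θ)
    (h1 : θ < 1) : EE q l θ ≤ 0 := by
  rw [← (DD_EE hq h0 h1).2]
  have hanti : AntitoneOn (DD q l) (Ico 0 1) := by
    refine antitoneOn_of_deriv_nonpos (convex_Ico 0 1)
      (fun x hx => (DD_deriv hq hx.1 hx.2).continuousAt.continuousWithinAt)
      (fun x hx => (DD_deriv hq (interior_subset hx).1
        (interior_subset hx).2).differentiableAt.differentiableWithinAt) ?_
    intro x hx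
    have hx := interior_subset hx
    rw [(DD_deriv hq hx.1 hx.2).deriv]
    have hu := upos hq hx.1 hx.2.le
    have hv : 0 < 1 - x := by linarith [hx.2]
    have e : (q - 1) / (1 + (q - 1) * x) + 1 / (1 - x) = q / ((1 + (q - 1) * x) * (1 - x)) := by
      field_simp
      ring
    have : q ≤ q / ((1 + (q - 1) * x) * (1 - x)) := by
      rw [le_div_iff₀ (by positivity)]
      have : (1 + (q - 1) * x) * (1 - x) ≤ 1 := by
        have h3 : q - 2 ≤ (q - 1) * x := by
          rcases le_total 1 q with h1 | h1
          · nlinarith [hx.1]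
          · nlinarith [hx.2]
        nlinarith [hx.1]
      nlinarith
    linarith
  have := hanti (a := 0) (b := θ) ⟨le_rfl, one_pos⟩ ⟨h0, h1⟩ h0
  simpa [DD] using this

/-- `F ≤ H` (Gibbs inequality). -/
lemma FF_le_HH {q l θ : ℝ} (hq : 0 < q) (hl : 0 < l) (h0 : 0 ≤ θ) (h1 : θ ≤ 1) :
    FF q l θ ≤ HH q l θ := by
  rcases eq_or_lt_of_le h0 with h | h
  · subst h; simp [FF, HH]
  have hz := z_lt hl h
  have hw : 0 < 1 - Real.exp (-(l * θ)) := by linarith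
  rcases eq_or_lt_of_le h1 with h' | h'
  · subst h'
    simp [FF, HH]
    rw [mul_one] at hw
    have := Real.log_nonpos hw.le (by linarith [Real.exp_pos (-l)])
    field_simp
    linarith
  have hu := upos hq h0 h1
  have hv : 0 < 1 - θ := by linarith
  have hp := Real.exp_pos (-(l * θ))
  have i1 := Real.log_le_sub_one_of_pos
    (x := (1 - Real.exp (-(l * θ))) * (1 + (q - 1) * θ) / (q * θ)) (by positivity)
  have i2 := Real.log_le_sub_one_of_pos
    (x := Real.exp (-(l * θ)) * (1 + (q - 1) * θ) / (1 - θ)) (by positivity)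
  have i1' := mul_le_mul_of_nonneg_left i1 (by positivity : 0 ≤ q * θ)
  have i2' := mul_le_mul_of_nonneg_left i2 hv.le
  rw [mul_sub, mul_div_cancel₀ _ (by positivity)] at i1'
  rw [mul_sub, mul_div_cancel₀ _ hv.ne'] at i2'
  rw [Real.log_div (by positivity) (by positivity), Real.log_mul hw.ne' hu.ne',
    Real.log_mul hq.ne' h.ne'] at i1'
  rw [Real.log_div (by positivity) hv.ne', Real.log_mul hp.ne' hu.ne', Real.log_exp] at i2'
  have e : q * (HH q l θ - FF q l θ) =
      -(q * θ * (Real.log (1 - Real.exp (-(l * θ))) + Real.log (1 + (q - 1) * θ)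
        - (Real.log q + Real.log θ)))
      - (1 - θ) * (-(l * θ) + Real.log (1 + (q - 1) * θ) - Real.log (1 - θ)) := by
    unfold HH FF
    field_simp
    ring
  have : 0 ≤ q * (HH q l θ - FF q l θ) := by
    rw [e]
    nlinarith
  have := nonneg_of_mul_nonneg_right this hq
  linarith

lemma EE_zero {q l θ : ℝ} (hq : 0 < q) (h0 : 0 ≤ θ) (h1 : θ < 1) (hE : EE q l θ = 0) :
    l * θ = Real.log (1 + (q - 1) * θ) - Real.log (1 - θ) := by
  have h2 := (DD_EE (l := l) hq h0 h1)
  have := le_antisymm (h2.2.2 hE.le) (h2.1.2 hE.ge)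
  unfold DD at this
  linarith

/-- value of `H` at mean field solutions -/
lemma HH_val {q l θ : ℝ} (hq : 0 < q) (h0 : 0 ≤ θ) (h1 : θ < 1) (hE : EE q l θ = 0) :
    HH q l θ = gfun q θ / (2 * q) - (q - 1) / (2 * q) * l + Real.log q := by
  have := EE_zero hq h0 h1 hE
  unfold HH gfun
  field_simp
  linear_combination (q - 1) * θ * this

lemma FF_val {q l θ : ℝ} (hq : 0 < q) (hl : 0 < l) (h0 : 0 ≤ θ) (h1 : θ < 1)
    (hE : EE q l θ = 0) :
    FF q l θ = gfun q θ / (2 * q) - (q - 1) / (2 * q) * l + Real.log q := by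
  rw [← HH_val hq h0 h1 hE]
  rcases eq_or_lt_of_le h0 with h | h
  · subst h; simp [FF, HH]
  have hz := z_lt hl h
  have hu := upos hq h0 h1.le
  have hv : 0 < 1 - θ := by linarith
  have hzz : 1 - Real.exp (-(l * θ)) = q * θ / (1 + (q - 1) * θ) := by
    have hm : Real.exp (l * θ) * Real.exp (-(l * θ)) = 1 := by rw [← Real.exp_add]; simp
    rw [eq_div_iff hu.ne']
    unfold EE at hE
    linear_combination Real.exp (-(l * θ)) * hE - (1 - θ) * hm
  have hlog := EE_zero hq h0 h1 hE
  unfold FF HH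
  rw [hzz, Real.log_div (by positivity) hu.ne', Real.log_mul hq.ne' h.ne']
  generalize Real.log (1 + (q - 1) * θ) = Lu at *
  field_simp
  linear_combination (-2 * (1 - θ)) * hlog

lemma HH_cont {q l : ℝ} : Continuous (HH q l) := by
  have h1 : Continuous (fun θ : ℝ => (1 + (q - 1) * θ) * Real.log (1 + (q - 1) * θ)) :=
    Real.continuous_mul_log.comp (by fun_prop : Continuous fun θ : ℝ => 1 + (q - 1) * θ)
  unfold HH
  exact (continuous_const.sub (continuous_const.mul
    (h1.add (continuous_const.mul cont_1mlog)))).sub (by fun_prop)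

lemma HH_deriv {q l θ : ℝ} (hq : 0 < q) (h0 : 0 ≤ θ) (h1 : θ < 1) :
    HasDerivAt (HH q l) ((q - 1) / q * DD q l θ) θ := by
  have hu := upos hq h0 h1.le
  have b1 : HasDerivAt (fun θ : ℝ => 1 + (q - 1) * θ) (q - 1) θ :=
    (((hasDerivAt_id' θ).const_mul (q - 1)).const_add 1).congr_deriv (by ring)
  have b2 : HasDerivAt (fun θ : ℝ => 1 - θ) (-1) θ := (hasDerivAt_id' θ).const_sub 1
  have a1 := (Real.hasDerivAt_mul_log hu.ne').comp θ b1
  have a2 := (Real.hasDerivAt_mul_log (x := 1 - θ) (by linarith)).comp θ b2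
  have a3 := (((hasDerivAt_id' θ).pow 2).const_sub 1).const_mul ((q - 1) / (2 * q) * l)
  have := (((a1.add (a2.const_mul (q - 1))).const_mul (1 / q)).const_sub (Real.log q)).sub a3
  refine this.congr_deriv ?_
  unfold DD
  field_simp
  ring

lemma HH_mono {q l a b : ℝ} (hq : 1 < q) (ha : 0 ≤ a) (hb : b ≤ 1)
    (hD : ∀ θ, a < θ → θ < b → 0 ≤ DD q l θ) : MonotoneOn (HH q l) (Icc a b) := by
  have hd : ∀ x ∈ interior (Icc a b), HasDerivAt (HH q l) ((q - 1) / q * DD q l x) x := by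
    intro x hx
    rw [interior_Icc] at hx
    exact HH_deriv (by linarith) (ha.trans hx.1.le) (hx.2.trans_le hb)
  refine monotoneOn_of_deriv_nonneg (convex_Icc a b) HH_cont.continuousOn
    (fun x hx => (hd x hx).differentiableAt.differentiableWithinAt) ?_
  intro x hx
  rw [(hd x hx).deriv]
  rw [interior_Icc] at hx
  exact mul_nonneg (div_nonneg (by linarith) (by linarith)) (hD x hx.1 hx.2)

lemma HH_anti {q l a b : ℝ} (hq : 1 < q) (ha : 0 ≤ a) (hb : b ≤ 1)
    (hD : ∀ θ, a < θ → θ < b → DD q l θ ≤ 0) : AntitoneOn (HH q l) (Icc a b) := by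
  have hd : ∀ x ∈ interior (Icc a b), HasDerivAt (HH q l) ((q - 1) / q * DD q l x) x := by
    intro x hx
    rw [interior_Icc] at hx
    exact HH_deriv (by linarith) (ha.trans hx.1.le) (hx.2.trans_le hb)
  refine antitoneOn_of_deriv_nonpos (convex_Icc a b) HH_cont.continuousOn
    (fun x hx => (hd x hx).differentiableAt.differentiableWithinAt) ?_
  intro x hx
  rw [(hd x hx).deriv]
  rw [interior_Icc] at hx
  exact mul_nonpos_of_nonneg_of_nonpos (div_nonneg (by linarith) (by linarith)) (hD x hx.1 hx.2)

lemma HH_shift {q l l' θ : ℝ} (hq : 0 < q) :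
    HH q l θ - HH q l 0 = HH q l' θ - HH q l' 0 + (l - l') * ((q - 1) / (2 * q)) * θ ^ 2 := by
  unfold HH
  ring

lemma crit_props {q : ℝ} (hq2 : 2 < q) :
    lamCrit q ≤ q ∧ DD q (lamCrit q) ((q - 2) / (q - 1)) = 0 ∧
    HH q (lamCrit q) ((q - 2) / (q - 1)) = HH q (lamCrit q) 0 ∧
    ∀ θ, 0 ≤ θ → θ ≤ 1 → HH q (lamCrit q) θ ≤ HH q (lamCrit q) 0 := by
  have hq : 0 < q := by linarith
  have hq1 : 0 < q - 1 := by linarith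
  have hq3 : 0 < q - 2 := by linarith
  have hlc : lamCrit q = 2 * ((q - 1) / (q - 2)) * Real.log (q - 1) := by
    unfold lamCrit; rw [if_neg (by linarith)]
  set c := (q - 2) / (q - 1) with hc
  have hcq : (q - 1) * c = q - 2 := by rw [hc]; field_simp
  have hc0 : 0 < c := by positivity
  have hc1 : c < 1 := by rw [hc, div_lt_one hq1]; linarith
  have hlcc : lamCrit q * c = 2 * Real.log (q - 1) := by rw [hlc, hc]; field_simp
  have hle : lamCrit q ≤ q := by
    rw [hlc]
    have := log_le_half (y := q - 1) (by linarith)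
    have e : q = 2 * ((q - 1) / (q - 2)) * (((q - 1) - 1 / (q - 1)) / 2) := by
      field_simp; ring
    calc 2 * ((q - 1) / (q - 2)) * Real.log (q - 1)
        ≤ 2 * ((q - 1) / (q - 2)) * (((q - 1) - 1 / (q - 1)) / 2) :=
          mul_le_mul_of_nonneg_left this (by positivity)
      _ = q := e.symm
  have hv : 1 - c = (q - 1)⁻¹ := by rw [hc]; field_simp; ring
  have hu : 1 + (q - 1) * c = q - 1 := by rw [hcq]; ring
  have hDc : DD q (lamCrit q) c = 0 := by
    unfold DD
    rw [hlcc, hu, hv, Real.log_inv]; ring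
  have hDh : DD q (lamCrit q) (c / 2) = 0 := by
    unfold DD
    have e1 : 1 + (q - 1) * (c / 2) = q / 2 := by linear_combination hcq / 2
    have e2 : 1 - c / 2 = (q / 2) / (q - 1) := by rw [hc]; field_simp; ring
    rw [e1, e2, Real.log_div (by positivity) hq1.ne']
    linear_combination hlcc / 2
  have hconc := DD_concave (q := q) (l := lamCrit q) (c := c / 2) hq (by positivity)
    (by linarith)
  have hsymm : ∀ θ, 0 ≤ θ → θ < 1 → HH q (lamCrit q) (c - θ) = HH q (lamCrit q) θ := by
    intro θ h0 h1
    have e1 : 1 + (q - 1) * (c - θ) = (q - 1) * (1 - θ) := by linear_combination hcq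
    have e2 : 1 - (c - θ) = (1 + (q - 1) * θ) / (q - 1) := by
      rw [hc]; field_simp; ring
    have hu := upos hq h0 h1.le
    unfold HH
    rw [e1, e2, Real.log_div hu.ne' hq1.ne', Real.log_mul hq1.ne' (by linarith)]
    generalize Real.log (1 + (q - 1) * θ) = Lu at *
    generalize Real.log (1 - θ) = Lv at *
    generalize Real.log (q - 1) = L at *
    generalize lamCrit q = lc at *
    field_simp
    linear_combination (q - 1) * (c - 2 * θ) * hlcc + (2 * L) * hcq
  have hc00 : HH q (lamCrit q) c = HH q (lamCrit q) 0 := by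
    have := hsymm 0 le_rfl one_pos
    rwa [sub_zero] at this
  have hmono := HH_mono (q := q) (l := lamCrit q) (a := c / 2) (b := c) (by linarith)
    (by positivity) hc1.le (fun θ h1 h2 =>
      conc_nonneg hconc le_rfl hc1 h1.le h2.le hDh.ge hDc.ge)
  have hanti := HH_anti (q := q) (l := lamCrit q) (a := c) (b := 1) (by linarith)
    hc0.le le_rfl (fun θ h1 h2 => by
      have := hconc.slope_anti_adjacent (x := c / 2) (y := c) (z := θ) ⟨le_rfl, by linarith⟩
        ⟨by linarith, h2⟩ (by linarith) h1
      rw [hDc, hDh, sub_self, zero_div, sub_zero] at this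
      by_contra! h3
      have := div_pos h3 (by linarith : 0 < θ - c)
      linarith)
  have hright : ∀ θ, c / 2 ≤ θ → θ ≤ 1 → HH q (lamCrit q) θ ≤ HH q (lamCrit q) 0 := by
    intro θ h1 h2
    rw [← hc00]
    rcases le_total θ c with h | h
    · exact hmono ⟨h1, h⟩ ⟨by linarith, le_rfl⟩ h
    · exact hanti ⟨le_rfl, hc1.le⟩ ⟨h, h2⟩ h
  refine ⟨hle, hDc, hc00, ?_⟩
  intro θ h0 h1
  rcases le_total (c / 2) θ with h | h
  · exact hright θ h h1
  · rw [← hsymm θ h0 (by linarith)]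
    exact hright _ (by linarith) (by linarith)

/-- The maximizer. -/
lemma main_aux {q l : ℝ} (hq : 0 < q) (hl : 0 < l) :
    0 ≤ thetaStar l q ∧ thetaStar l q < 1 ∧ EE q l (thetaStar l q) = 0 ∧
    l * (1 - thetaStar l q) ≤ q ∧
    ∀ θ, 0 ≤ θ → θ ≤ 1 → Phi θ l q ≤ FF q l (thetaStar l q) := by
  have hE0 : EE q l 0 = 0 := by simp [EE]
  rcases le_or_gt q 2 with hq2 | hq2
  · have hlc : lamCrit q = q := by unfold lamCrit; rw [if_pos hq2]
    unfold thetaStar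
    rw [hlc]
    split_ifs with h
    · refine ⟨le_rfl, one_pos, hE0, by linarith, fun θ h0 h1 => ?_⟩
      exact small_bound hq hl one_pos le_rfl (by linarith) (fun x h2 h3 => by linarith)
        (fun x h2 h3 => EE_neg hq hq2 h.le h2.le h3) h0 h1
    · obtain ⟨p1, p2, p3, p4, p5, p6⟩ := thetaMax_props (c := 0) hq hl le_rfl one_pos
        (by linarith) hE0.ge
      refine ⟨p1, p2, p3, p6, fun θ h0 h1 => ?_⟩
      exact small_bound hq hl p2 p1 p6 (fun x h2 h3 => p4 x h2.le h3.le)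
        (fun x h2 h3 => (p5 x h2 h3.le).le) h0 h1
  · obtain ⟨c1, c2, c3, c4⟩ := crit_props hq2
    have hfac : 0 ≤ (q - 1) / (2 * q) := div_nonneg (by linarith) (by linarith)
    unfold thetaStar
    split_ifs with h
    · refine ⟨le_rfl, one_pos, hE0, by linarith, fun θ h0 h1 => ?_⟩
      refine (Phi_le_FF h1).trans ((FF_le_HH hq hl h0 h1).trans ?_)
      rw [FF_val hq hl le_rfl one_pos hE0, ← HH_val hq le_rfl one_pos hE0]
      have e := HH_shift (l := l) (l' := lamCrit q) (θ := θ) hq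
      have := c4 θ h0 h1
      have h3 : (l - lamCrit q) * ((q - 1) / (2 * q)) * θ ^ 2 ≤ 0 :=
        mul_nonpos_of_nonpos_of_nonneg
          (mul_nonpos_of_nonpos_of_nonneg (by linarith) hfac) (sq_nonneg _)
      linarith
    · have h := not_lt.1 h
      have hq1 : 0 < q - 1 := by linarith
      have hc0 : 0 < (q - 2) / (q - 1) := div_pos (by linarith) hq1
      have hc1 : (q - 2) / (q - 1) < 1 := by rw [div_lt_one hq1]; linarith
      have hcq : (q - 1) * ((q - 2) / (q - 1)) = q - 2 := by field_simp
      set c := (q - 2) / (q - 1) with hc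
      have hDc : 0 ≤ DD q l c := by
        have : DD q l c = DD q (lamCrit q) c + (l - lamCrit q) * c := by unfold DD; ring
        rw [this, c2, zero_add]
        exact mul_nonneg (by linarith) hc0.le
      obtain ⟨p1, p2, p3, p4, p5, p6⟩ := thetaMax_props (c := c) hq hl hc0.le hc1
        (by linarith) ((DD_EE hq hc0.le hc1).1.1 hDc)
      have p0 := hc0.le.trans p1
      refine ⟨p0, p2, p3, p6, fun θ h0 h1 => ?_⟩
      refine (Phi_le_FF h1).trans ((FF_le_HH hq hl h0 h1).trans ?_)
      rw [FF_val hq hl p0 p2 p3, ← HH_val hq p0 p2 p3]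
      have hmono := HH_mono (q := q) (l := l) (a := c) (b := thetaMax l q) (by linarith)
        hc0.le p2.le (fun x h2 h3 =>
          (DD_EE hq (hc0.le.trans h2.le) (h3.trans p2)).1.2 (p4 x h2.le h3.le))
      have hanti := HH_anti (q := q) (l := l) (a := thetaMax l q) (b := 1) (by linarith)
        p0 le_rfl (fun x h2 h3 => (DD_EE hq (p0.trans h2.le) h3).2.2 (p5 x h2 h3.le).le)
      rcases le_total (thetaMax l q) θ with h2 | h2
      · exact hanti ⟨le_rfl, p2.le⟩ ⟨h2, h1⟩ h2
      rcases le_total c θ with h3 | h3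
      · exact hmono ⟨h3, h2⟩ ⟨p1, le_rfl⟩ h2
      refine le_trans ?_ (hmono ⟨le_rfl, p1⟩ ⟨p1, le_rfl⟩ p1)
      have e := HH_shift (l := l) (l' := lamCrit q) (θ := θ) hq
      have e' := HH_shift (l := l) (l' := lamCrit q) (θ := c) hq
      have := c4 θ h0 h1
      have h4 : (l - lamCrit q) * ((q - 1) / (2 * q)) * θ ^ 2 ≤
          (l - lamCrit q) * ((q - 1) / (2 * q)) * c ^ 2 :=
        mul_le_mul_of_nonneg_left (by gcongr) (mul_nonneg (by linarith) hfac)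
      linarith

/-- Let `q > 0` and `λ > 0`. Then
`sup_{θ∈[0,1]} Φ(θ,λ,q) = g(θ(λ,q))/(2q) − ((q−1)/(2q))λ + log q`. -/
theorem stmt15 (q lam : ℝ) (hq : 0 < q) (hlam : 0 < lam) :
    sSup ((fun θ => Phi θ lam q) '' Set.Icc (0:ℝ) 1) =
      gfun q (thetaStar lam q) / (2 * q) - ((q - 1) / (2 * q)) * lam + Real.log q := by
  obtain ⟨h0, h1, hE, hreg, hb⟩ := main_aux hq hlam
  rw [← FF_val hq hlam h0 h1 hE]
  refine IsGreatest.csSup_eq ⟨⟨thetaStar lam q, ⟨h0, h1.le⟩, ?_⟩, ?_⟩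
  · exact Phi_eq_FF hq hlam h1 hreg
  · rintro _ ⟨θ, hθ, rfl⟩
    exact hb θ hθ.1 hθ.2
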